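/- For every real number X, F_p(1,1;X) = ((1 − X)(X + p)/p) · (X² − (p² − p)X + 1). -/

import Mathlib

/-- The symbol `[u,v]` of Hironaka, for integers `u ≥ v ≥ 0`. -/
noncomputable def bsym (p u v : ℕ) : ℚ :=
  (∏ i ∈ Finset.Icc 1 u, (1 - (-(p : ℚ))⁻¹ ^ i)) /
    ((∏ i ∈ Finset.Icc 1 v, (1 - (-(p : ℚ))⁻¹ ^ i)) *
      (∏ i ∈ Finset.Icc 1 (u - v), (1 - (-(p : ℚ))⁻¹ ^ i)))

/-- For a pair `a = (a₁, a₂)`, the quantity `a'_i = #{j ∈ {1,2} : a_j ≥ i}`. -/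
def dualCt (a : ℕ × ℕ) (i : ℕ) : ℕ :=
  (if i ≤ a.1 then 1 else 0) + (if i ≤ a.2 then 1 else 0)

/-- Hironaka's local factor `I_j(μ, λ)`, for pairs `μ = (c,d)`, `λ = (λ₁,λ₂)`. -/
noncomputable def hirI (p : ℕ) (μ lam : ℕ × ℕ) (j : ℕ) : ℚ :=
  ∑ i ∈ Finset.Icc (dualCt μ (j + 1))
      (min (dualCt (lam.1 + 1, lam.2 + 1) (j + 1)) (dualCt μ j)),
    (-(p : ℚ)) ^ (i * (2 * dualCt (lam.1 + 1, lam.2 + 1) (j + 1) + 1 - i) / 2) *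
      bsym p (dualCt (lam.1 + 1, lam.2 + 1) (j + 1) - dualCt μ (j + 1))
        (dualCt (lam.1 + 1, lam.2 + 1) (j + 1) - i) *
      bsym p (dualCt (lam.1 + 1, lam.2 + 1) j - i)
        (dualCt (lam.1 + 1, lam.2 + 1) j - dualCt μ j)

/-- `ε_n = 0` if `n = 0` and `1` otherwise. -/
def epsn (n : ℕ) : ℕ := if n = 0 then 0 else 1

/-- The specialization `F_p(a,b;X)` of Hironaka's formula for Hermitian representation
densities: `α(diag(p,1) ⊕ 1_r, diag(p^a, p^b)) = F_p(a,b;(-p)^{-r})`. -/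
noncomputable def Fp (p a b : ℕ) (X : ℝ) : ℝ :=
  ∑ c ∈ Finset.range (a + 2), ∑ d ∈ Finset.range (min c (b + 1) + 1),
    (-1 : ℝ) ^ d * ((p : ℝ) ^ (2 * d + c))⁻¹ * X ^ (c + d) *
      (-(p : ℝ)) ^ (epsn c + epsn d) *
      ∏ j ∈ Finset.Icc 1 (a + 1), ((hirI p (c, d) (a, b) j : ℚ) : ℝ)

theorem one_sub_neg_inv_pow_ne_zero (p : ℕ) (hp : 1 < p) (n : ℕ) (hn : n ≠ 0) :
    1 - (-(p : ℚ))⁻¹ ^ n ≠ 0 := by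
  have hp' : (1 : ℚ) < p := by exact_mod_cast hp
  have h : |(-(p : ℚ))⁻¹ ^ n| < 1 := by
    rw [abs_pow, abs_inv, abs_neg, abs_of_pos (by linarith)]
    exact pow_lt_one₀ (by positivity) (inv_lt_one_of_one_lt₀ hp') hn
  intro h0
  rw [← sub_eq_zero.mp h0] at h
  norm_num at h

theorem bsym_self (p : ℕ) (hp : 1 < p) (u : ℕ) : bsym p u u = 1 := by
  have h : ∏ i ∈ Finset.Icc 1 u, (1 - (-(p : ℚ))⁻¹ ^ i) ≠ 0 :=
    Finset.prod_ne_zero_iff.mpr fun i hi =>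
      one_sub_neg_inv_pow_ne_zero p hp i (by have := Finset.mem_Icc.mp hi; omega)
  rw [bsym, Nat.sub_self, Finset.Icc_eq_empty_of_lt zero_lt_one, Finset.prod_empty, mul_one,
    div_self h]

theorem bsym_zero_right (p : ℕ) (hp : 1 < p) (u : ℕ) : bsym p u 0 = 1 := by
  have h := bsym_self p hp u
  simpa [bsym] using h

theorem bsym_two_one (p : ℕ) (hp : 1 < p) : bsym p 2 1 = 1 - (p : ℚ)⁻¹ := by
  have h1 := one_sub_neg_inv_pow_ne_zero p hp 1 one_ne_zero
  have h : bsym p 2 1 = 1 + (-(p : ℚ))⁻¹ := by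
    simp only [bsym, Finset.prod_Icc_succ_top (show 1 ≤ 1 + 1 by norm_num), Finset.Icc_self,
      Finset.prod_singleton, show 2 - 1 = 1 from rfl]
    rw [div_eq_iff (mul_ne_zero h1 h1)]
    ring
  rw [h, inv_neg, sub_eq_add_neg]

theorem statement15 (p : ℕ) (hp : p.Prime) (hodd : Odd p) (X : ℝ) :
    Fp p 1 1 X = ((1 - X) * (X + p) / p) * (X ^ 2 - ((p : ℝ) ^ 2 - p) * X + 1) := by
  have hp0 : (p : ℝ) ≠ 0 := Nat.cast_ne_zero.mpr hp.ne_zero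
  have h1 := bsym_self p hp.one_lt
  have h2 := bsym_zero_right p hp.one_lt
  have h3 := bsym_two_one p hp.one_lt
  have e01 : Finset.Icc 0 1 = {0, 1} := rfl
  have e02 : Finset.Icc 0 2 = {0, 1, 2} := rfl
  have e12 : Finset.Icc 1 2 = {1, 2} := rfl
  simp [Fp, hirI, dualCt, epsn, Finset.sum_range_succ, e01, e02, e12, h1, h2, h3]
  field_simp
  ring
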